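/- arXiv:2110.04723 — 5 statements merged into one kernel-verified Lean document; each statement's English description precedes it below -/
import Mathlib

section
/- Every odd diagram class in the symmetric group S_n is an interval in the Bruhat order; that is, for every odd diagram D there exist permutations u ≤ v in S_n such that Perm(D) = {w ∈ S_n : u ≤ w ≤ v}. -/
open Equiv Finset Polynomial

/-- The odd diagram of a permutation of `Fin n` (0-based positions and values):
boxes `(i, j)` with `w i > j`, `i < w⁻¹ j`, and `i`, `w⁻¹ j` of different parity. -/
def oddDiagram {n : ℕ} (w : Equiv.Perm (Fin n)) : Set (Fin n × Fin n) :=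
  {p | p.2 < w p.1 ∧ p.1 < w⁻¹ p.2 ∧ ((p.1 : ℕ) % 2 ≠ ((w⁻¹ p.2 : Fin n) : ℕ) % 2)}

/-- The Bruhat order on `S_n`: the reflexive-transitive closure of the relations
`x < x * (i j)` whenever `i < j` and `x i < x j`. -/
def bruhatLE {n : ℕ} : Equiv.Perm (Fin n) → Equiv.Perm (Fin n) → Prop :=
  Relation.ReflTransGen (fun x y => ∃ i j : Fin n, i < j ∧ x i < x j ∧ y = x * Equiv.swap i j)

/-- Strict Bruhat order. -/
def bruhatLT {n : ℕ} (x y : Equiv.Perm (Fin n)) : Prop := bruhatLE x y ∧ x ≠ y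

/-- The Coxeter length of a permutation, i.e. its number of inversions. -/
def invLength {n : ℕ} (w : Equiv.Perm (Fin n)) : ℕ :=
  (Finset.univ.filter (fun p : Fin n × Fin n => p.1 < p.2 ∧ w p.2 < w p.1)).card

/-- `swap i k` is an upward Bruhat move of `x` within the positions of parity `c` that keeps the
odd diagram fixed. -/
def OddEdge {n : ℕ} (c : ℕ) (x : Equiv.Perm (Fin n)) (i k : Fin n) : Prop :=
  i < k ∧ x i < x k ∧ (i : ℕ) % 2 = c ∧ (k : ℕ) % 2 = c ∧
    ∀ s : Fin n, (s : ℕ) % 2 ≠ c → i < s → x s < x i ∨ (x k < x s ∧ k < s)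

/-- One step along an edge of parity `c`. -/
def OddStep {n : ℕ} (c : ℕ) (x y : Equiv.Perm (Fin n)) : Prop :=
  ∃ i k, OddEdge c x i k ∧ y = x * Equiv.swap i k

/-- One step along an edge of either parity. -/
def AnyOddStep {n : ℕ} (x y : Equiv.Perm (Fin n)) : Prop := ∃ c, OddStep c x y

/-- The rank function of a permutation. -/
def rankFn {n : ℕ} (w : Equiv.Perm (Fin n)) (p q : ℕ) : ℕ :=
  ∑ l : Fin n, if (l : ℕ) ≤ p ∧ q ≤ (w l : ℕ) then 1 else 0

/-- The cell `(p, q)` lies in the rectangle of some parity-`c` edge reachable from `x`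
by parity-`c` steps. -/
def Covered {n : ℕ} (c : ℕ) (x : Equiv.Perm (Fin n)) (p q : ℕ) : Prop :=
  ∃ y i k, Relation.ReflTransGen (OddStep c) x y ∧ OddEdge c y i k ∧
    (i : ℕ) ≤ p ∧ p < (k : ℕ) ∧ (y i : ℕ) < q ∧ q ≤ (y k : ℕ)

section OddDiagram

variable {n : ℕ}

lemma mem_oddDiagram (w : Equiv.Perm (Fin n)) (r s : Fin n) :
    (r, w s) ∈ oddDiagram w ↔ w s < w r ∧ r < s ∧ (r : ℕ) % 2 ≠ (s : ℕ) % 2 := by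
  simp [oddDiagram]

lemma mem_oddDiagram_val (w : Equiv.Perm (Fin n)) (r j : Fin n) :
    (r, j) ∈ oddDiagram w ↔
      j < w r ∧ r < w.symm j ∧ (r : ℕ) % 2 ≠ ((w.symm j : Fin n) : ℕ) % 2 :=
  Iff.rfl

lemma OddEdge.oddDiagram_eq {c : ℕ} {x : Equiv.Perm (Fin n)} {i k : Fin n}
    (h : OddEdge c x i k) : oddDiagram (x * Equiv.swap i k) = oddDiagram x := by
  obtain ⟨hik, hx, hi, hk, hs⟩ := h
  ext ⟨r, j⟩
  obtain ⟨s, rfl⟩ := (x * Equiv.swap i k).surjective j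
  rw [mem_oddDiagram]
  have e : (x * Equiv.swap i k) s = x (Equiv.swap i k s) := rfl
  have e' : (x * Equiv.swap i k) r = x (Equiv.swap i k r) := rfl
  rw [e, e', mem_oddDiagram]
  have inj : ∀ a b, x a = x b → a = b := fun a b h => x.injective h
  have hr := hs r
  have hs' := hs s
  clear hs e e'
  rw [Equiv.swap_apply_def, Equiv.swap_apply_def]
  split_ifs <;> subst_vars <;> grind

/-- An edge is unaffected by a move of the other parity. -/
lemma OddEdge.mul_swap_iff {c d : ℕ} (hcd : c ≠ d) {x : Equiv.Perm (Fin n)} {i k i' k' : Fin n}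
    (h : OddEdge c x i k) :
    OddEdge d (x * Equiv.swap i k) i' k' ↔ OddEdge d x i' k' := by
  obtain ⟨hik, hx, hi, hk, hs⟩ := h
  unfold OddEdge
  refine and_congr_right fun h1 => ?_
  have key : (i' : ℕ) % 2 = d → (k' : ℕ) % 2 = d →
      (x * Equiv.swap i k) i' = x i' ∧ (x * Equiv.swap i k) k' = x k' := by
    intro a b
    simp only [Equiv.Perm.mul_apply]
    rw [Equiv.swap_apply_of_ne_of_ne (by grind) (by grind),
      Equiv.swap_apply_of_ne_of_ne (by grind) (by grind)]
    exact ⟨rfl, rfl⟩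
  have inj : ∀ a b, x a = x b → a = b := fun a b h => x.injective h
  have hi' := hs i'
  have hk' := hs k'
  constructor
  · rintro ⟨h2, h3, h4, h5⟩
    obtain ⟨e1, e2⟩ := key h3 h4
    rw [e1, e2] at h2 h5
    refine ⟨h2, h3, h4, fun s hs1 hs2 => ?_⟩
    have A := h5 i (by grind)
    have B := h5 k (by grind)
    have C := h5 s hs1 hs2
    simp only [Equiv.Perm.mul_apply, Equiv.swap_apply_left, Equiv.swap_apply_right] at A B C
    rw [Equiv.swap_apply_def] at C
    have := inj i i'
    have := inj i k'
    have := inj k i'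
    have := inj k k'
    clear key h5 inj hs
    grind
  · rintro ⟨h2, h3, h4, h5⟩
    obtain ⟨e1, e2⟩ := key h3 h4
    rw [e1, e2]
    refine ⟨h2, h3, h4, fun s hs1 hs2 => ?_⟩
    have A := h5 i (by grind)
    have B := h5 k (by grind)
    have C := h5 s hs1 hs2
    simp only [Equiv.Perm.mul_apply]
    rw [Equiv.swap_apply_def]
    have := inj i i'
    have := inj i k'
    have := inj k i'
    have := inj k k'
    clear key h5 inj hs
    grind

lemma OddEdge.mul_swap_comm {c d : ℕ} (hcd : c ≠ d) {x y z : Equiv.Perm (Fin n)}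
    {i k i' k' : Fin n} (h : OddEdge c x i k) (h' : OddEdge d y i' k') :
    z * Equiv.swap i k * Equiv.swap i' k' = z * Equiv.swap i' k' * Equiv.swap i k := by
  obtain ⟨hik, -, hi, hk, -⟩ := h
  obtain ⟨hik', -, hi', hk', -⟩ := h'
  rw [mul_assoc, mul_assoc]
  congr 1
  refine (Equiv.Perm.disjoint_iff_disjoint_support.2 ?_).commute.eq
  rw [Equiv.Perm.support_swap hik.ne, Equiv.Perm.support_swap hik'.ne]
  simp only [Finset.disjoint_insert_left, Finset.disjoint_singleton_left, Finset.mem_insert,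
    Finset.mem_singleton]
  grind

/-- Edges of one parity persist along paths of the other parity. -/
lemma oddEdge_iff_of_path {c d : ℕ} (hcd : c ≠ d) {x y : Equiv.Perm (Fin n)}
    (h : Relation.ReflTransGen (OddStep c) x y) {i k : Fin n} :
    OddEdge d y i k ↔ OddEdge d x i k := by
  induction h with
  | refl => rfl
  | tail _ h ih =>
    obtain ⟨a, b, e, rfl⟩ := h
    rw [e.mul_swap_iff hcd, ih]

lemma apply_eq_of_path {c : ℕ} {x y : Equiv.Perm (Fin n)}
    (h : Relation.ReflTransGen (OddStep c) x y) {s : Fin n} (hs : (s : ℕ) % 2 ≠ c) :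
    y s = x s := by
  induction h with
  | refl => rfl
  | tail _ h ih =>
    obtain ⟨a, b, ⟨-, -, ha, hb, -⟩, rfl⟩ := h
    rw [← ih, Equiv.Perm.mul_apply, Equiv.swap_apply_of_ne_of_ne (by grind) (by grind)]

lemma path_mul_swap {c d : ℕ} (hcd : c ≠ d) {x z : Equiv.Perm (Fin n)} {i k : Fin n}
    (h : OddEdge c x i k) (hz : Relation.ReflTransGen (OddStep d) x z) :
    Relation.ReflTransGen (OddStep d) (x * Equiv.swap i k) (z * Equiv.swap i k) := by
  induction hz with
  | refl => rfl
  | @tail y z hp hs ih =>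
    have e := (oddEdge_iff_of_path hcd.symm hp).2 h
    obtain ⟨a, b, e', rfl⟩ := hs
    refine ih.tail ⟨a, b, (e.mul_swap_iff hcd).2 e', ?_⟩
    rw [e.mul_swap_comm hcd e']

lemma path_of_path_mul_swap {c d : ℕ} (hcd : c ≠ d) {x z : Equiv.Perm (Fin n)} {i k : Fin n}
    (h : OddEdge c x i k) (hz : Relation.ReflTransGen (OddStep d) (x * Equiv.swap i k) z) :
    ∃ y, z = y * Equiv.swap i k ∧ Relation.ReflTransGen (OddStep d) x y := by
  induction hz with
  | refl => exact ⟨x, rfl, .refl⟩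
  | tail _ hs ih =>
    obtain ⟨y, rfl, hy⟩ := ih
    have e := (oddEdge_iff_of_path hcd.symm hy).2 h
    obtain ⟨a, b, e', rfl⟩ := hs
    have e'' := (e.mul_swap_iff hcd).1 e'
    exact ⟨y * Equiv.swap a b, e.mul_swap_comm hcd e'', hy.tail ⟨a, b, e'', rfl⟩⟩

/-- The rectangles of two edges of different parities do not contain neighbouring cells. -/
lemma OddEdge.not_adjacent {c d : ℕ} (hcd : c ≠ d) {x : Equiv.Perm (Fin n)} {i k i' k' : Fin n}
    (h : OddEdge c x i k) (h' : OddEdge d x i' k') {p q p' q' : ℕ}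
    (hp : p ≤ p' + 1) (hp' : p' ≤ p + 1) (hq : q ≤ q' + 1) (hq' : q' ≤ q + 1)
    (h1 : (i : ℕ) ≤ p) (h2 : p < (k : ℕ)) (h3 : (x i : ℕ) < q) (h4 : q ≤ (x k : ℕ))
    (h1' : (i' : ℕ) ≤ p') (h2' : p' < (k' : ℕ)) (h3' : (x i' : ℕ) < q')
    (h4' : q' ≤ (x k' : ℕ)) : False := by
  obtain ⟨_, _, hi, hk, hs⟩ := h
  obtain ⟨_, _, hi', hk', hs'⟩ := h'
  have inj : ∀ a b : Fin n, (x a : ℕ) = x b → (a : ℕ) = b := fun a b h => by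
    rw [x.injective (Fin.ext h)]
  have A := hs i' (by omega)
  have B := hs k' (by omega)
  have C := hs' i (by omega)
  have E := hs' k (by omega)
  have := inj i i'
  have := inj i k'
  have := inj k i'
  have := inj k k'
  clear inj hs hs'
  simp only [Fin.lt_def] at *
  omega

lemma Covered.not_adjacent {c d : ℕ} (hcd : c ≠ d) {x : Equiv.Perm (Fin n)} {p q p' q' : ℕ}
    (h : Covered c x p q) (h' : Covered d x p' q')
    (hp : p ≤ p' + 1) (hp' : p' ≤ p + 1) (hq : q ≤ q' + 1) (hq' : q' ≤ q + 1) : False := by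
  obtain ⟨y, i, k, hy, e, h1, h2, h3, h4⟩ := h
  obtain ⟨z, i', k', hz, e', h1', h2', h3', h4'⟩ := h'
  induction hy using Relation.ReflTransGen.head_induction_on generalizing z with
  | refl =>
    have e1 := (oddEdge_iff_of_path hcd.symm hz).2 e
    rw [← apply_eq_of_path hz (by rw [e.2.2.1]; exact hcd)] at h3
    rw [← apply_eq_of_path hz (by rw [e.2.2.2.1]; exact hcd)] at h4
    exact e1.not_adjacent hcd e' hp hp' hq hq' h1 h2 h3 h4 h1' h2' h3' h4'
  | head hs _ ih =>
    obtain ⟨a, b, e2, rfl⟩ := hs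
    have e3 := (oddEdge_iff_of_path hcd.symm hz).2 e2
    have st : Relation.ReflTransGen (OddStep c) z (z * Equiv.swap a b) :=
      .single ⟨a, b, e3, rfl⟩
    refine ih (z * Equiv.swap a b) (path_mul_swap hcd e2 hz) ((e3.mul_swap_iff hcd).2 e') ?_ ?_
    · rwa [apply_eq_of_path st (by rw [e'.2.2.1]; exact hcd.symm)]
    · rwa [apply_eq_of_path st (by rw [e'.2.2.2.1]; exact hcd.symm)]

/-- A covered cell is not adjacent to the left-down hook of a point of the other parity. -/
lemma Covered.avoids_hook {c : ℕ} {x : Equiv.Perm (Fin n)} {p q : ℕ} (h : Covered c x p q)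
    {s : Fin n} (hs : (s : ℕ) % 2 ≠ c)
    (hadj : (p ≤ (s : ℕ) ∧ ((x s : ℕ) = q ∨ (x s : ℕ) + 1 = q)) ∨
      (q ≤ (x s : ℕ) + 1 ∧ ((s : ℕ) = p ∨ (s : ℕ) = p + 1))) : False := by
  obtain ⟨y, i, k, hy, ⟨_, _, hi, hk, he⟩, h1, h2, h3, h4⟩ := h
  have A := he s hs
  have inj : ∀ a b : Fin n, (y a : ℕ) = y b → (a : ℕ) = b := fun a b h => by
    rw [y.injective (Fin.ext h)]
  have := inj s i
  have := inj s k
  rw [← apply_eq_of_path hy hs] at hadj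
  clear inj he
  simp only [Fin.lt_def] at *
  omega

lemma rankFn_mul_swap {x : Equiv.Perm (Fin n)} {i k : Fin n} (hik : i < k) (hx : x i < x k)
    (p q : ℕ) : rankFn (x * Equiv.swap i k) p q = rankFn x p q +
      if (i : ℕ) ≤ p ∧ p < (k : ℕ) ∧ (x i : ℕ) < q ∧ q ≤ (x k : ℕ) then 1 else 0 := by
  have split : ∀ f : Fin n → ℕ, ∑ l, f l = f i + (f k + ∑ l ∈ (univ.erase i).erase k, f l) := by
    intro f
    rw [Finset.add_sum_erase _ _ (by simp [hik.ne']), Finset.add_sum_erase _ _ (by simp)]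
  unfold rankFn
  rw [split, split]
  have : ∑ l ∈ (univ.erase i).erase k,
        (if (l : ℕ) ≤ p ∧ q ≤ ((x * Equiv.swap i k) l : ℕ) then 1 else 0) =
      ∑ l ∈ (univ.erase i).erase k, if (l : ℕ) ≤ p ∧ q ≤ (x l : ℕ) then 1 else 0 := by
    refine Finset.sum_congr rfl fun l hl => ?_
    simp only [Finset.mem_erase] at hl
    rw [Equiv.Perm.mul_apply, Equiv.swap_apply_of_ne_of_ne hl.2.1 hl.1]
  rw [this]
  simp only [Equiv.Perm.mul_apply, Equiv.swap_apply_left, Equiv.swap_apply_right, Fin.lt_def] at *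
  split_ifs <;> omega

lemma bruhatLE.rankFn_le {x y : Equiv.Perm (Fin n)} (h : bruhatLE x y) (p q : ℕ) :
    rankFn x p q ≤ rankFn y p q := by
  induction h with
  | refl => rfl
  | tail _ h ih =>
    obtain ⟨i, k, hik, hx, rfl⟩ := h
    rw [rankFn_mul_swap hik hx]
    omega

lemma bruhatLE_of_path {x y : Equiv.Perm (Fin n)} (h : Relation.ReflTransGen AnyOddStep x y) :
    bruhatLE x y := by
  induction h with
  | refl => exact .refl
  | tail _ hs ih =>
    obtain ⟨c, i, k, e, rfl⟩ := hs
    exact ih.tail ⟨i, k, e.1, e.2.1, rfl⟩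

lemma exists_covered_of_path {x v : Equiv.Perm (Fin n)}
    (h : Relation.ReflTransGen AnyOddStep x v) {p q : ℕ} (hr : rankFn x p q < rankFn v p q) :
    ∃ c, Covered c x p q := by
  induction h using Relation.ReflTransGen.head_induction_on with
  | refl => exact absurd hr (lt_irrefl _)
  | head hs _ ih =>
    obtain ⟨c, i, k, e, rfl⟩ := hs
    rw [rankFn_mul_swap e.1 e.2.1] at ih
    split_ifs at ih with hc
    · exact ⟨c, _, i, k, .refl, e, hc⟩
    · obtain ⟨d, y, a, b, hy, e', h1, h2, h3, h4⟩ := ih (by omega)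
      by_cases hcd : c = d
      · subst hcd
        exact ⟨c, y, a, b, hy.head ⟨i, k, e, rfl⟩, e', h1, h2, h3, h4⟩
      · obtain ⟨z, rfl, hz⟩ := path_of_path_mul_swap hcd e hy
        have e1 := (oddEdge_iff_of_path (Ne.symm hcd) hz).2 e
        have st : Relation.ReflTransGen (OddStep c) z (z * Equiv.swap i k) :=
          .single ⟨i, k, e1, rfl⟩
        rw [apply_eq_of_path st (by rw [e'.2.2.1]; exact Ne.symm hcd)] at h3
        rw [apply_eq_of_path st (by rw [e'.2.2.2.1]; exact Ne.symm hcd)] at h4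
        exact ⟨d, z, a, b, hz, (e1.mul_swap_iff hcd).1 e', h1, h2, h3, h4⟩

/-- A Bruhat move from `x` that stays below a permutation reachable from `x` by odd steps is
itself an odd step. -/
lemma oddEdge_of_bruhatLE {x v : Equiv.Perm (Fin n)}
    (h : Relation.ReflTransGen AnyOddStep x v) {i k : Fin n} (hik : i < k) (hx : x i < x k)
    (hv : bruhatLE (x * Equiv.swap i k) v) : ∃ c, OddEdge c x i k := by
  have hcov : ∀ p q : ℕ, (i : ℕ) ≤ p → p < (k : ℕ) → (x i : ℕ) < q → q ≤ (x k : ℕ) →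
      ∃ c, Covered c x p q := by
    intro p q h1 h2 h3 h4
    refine exists_covered_of_path h (lt_of_lt_of_le ?_ (hv.rankFn_le p q))
    rw [rankFn_mul_swap hik hx, if_pos ⟨h1, h2, h3, h4⟩]
    exact Nat.lt_succ_self _
  have hik' : (i : ℕ) < k := hik
  have hx' : (x i : ℕ) < x k := hx
  obtain ⟨c, hc⟩ := hcov i (x i + 1) le_rfl hik' (by omega) (by omega)
  have hrow : ∀ p : ℕ, (i : ℕ) ≤ p → p < (k : ℕ) → Covered c x p (x i + 1) := by
    intro p hp
    induction p, hp using Nat.le_induction with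
    | base => exact fun _ => hc
    | succ p hp ih =>
      intro hk
      obtain ⟨d, hd⟩ := hcov (p + 1) (x i + 1) (by omega) hk (by omega) (by omega)
      by_cases hcd : c = d
      · exact hcd ▸ hd
      · exact ((ih (by omega)).not_adjacent hcd hd (by omega) (by omega) (by omega)
          (by omega)).elim
  have hall : ∀ p q : ℕ, (i : ℕ) ≤ p → p < (k : ℕ) → (x i : ℕ) + 1 ≤ q → q ≤ (x k : ℕ) →
      Covered c x p q := by
    intro p q h1 h2 h3
    induction q, h3 using Nat.le_induction with
    | base => exact fun _ => hrow p h1 h2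
    | succ q hq ih =>
      intro hk
      obtain ⟨d, hd⟩ := hcov p (q + 1) h1 h2 (by omega) hk
      by_cases hcd : c = d
      · exact hcd ▸ hd
      · exact ((ih (by omega)).not_adjacent hcd hd (by omega) (by omega) (by omega)
          (by omega)).elim
  refine ⟨c, hik, hx, ?_, ?_, fun s hs his => ?_⟩
  · by_contra hi
    exact hc.avoids_hook hi (by omega)
  · by_contra hk
    exact (hall (k - 1) (x k) (by omega) (by omega) (by omega) le_rfl).avoids_hook hk (by omega)
  · have his' : (i : ℕ) < s := his
    simp only [Fin.lt_def]
    by_contra hcon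
    have hne : (x s : ℕ) ≠ x i := fun e => by
      have := x.injective (Fin.ext e); omega
    by_cases hsk : (s : ℕ) < k
    · exact (hall s (x i + 1) (by omega) hsk le_rfl (by omega)).avoids_hook hs (by omega)
    · by_cases hks : s = k
      · subst hks
        exact (hall (s - 1) (x s) (by omega) (by omega) (by omega) le_rfl).avoids_hook hs
          (by omega)
      · exact (hall i (x s) le_rfl hik' (by omega) (by omega)).avoids_hook hs (by omega)

/-- At the first position where two permutations with the same odd diagram differ, the one with
the larger value has a downward odd step. -/
lemma oddEdge_of_first_position {x y : Equiv.Perm (Fin n)} (hD : oddDiagram x = oddDiagram y)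
    {i : Fin n} (hlt : ∀ j < i, x j = y j) (hi : x i < y i) :
    OddEdge ((i : ℕ) % 2) (y * Equiv.swap i (y.symm (x i))) i (y.symm (x i)) := by
  obtain ⟨l, hl⟩ := y.surjective (x i)
  have hl' : y.symm (x i) = l := by rw [← hl, Equiv.symm_apply_apply]
  rw [hl']
  have hil : i < l := by
    rcases lt_trichotomy l i with h | h | h
    · exact absurd (x.injective ((hlt l h).trans hl)) h.ne
    · subst h; exact absurd hl hi.ne'
    · exact h
  have mem : ∀ r j, (r, j) ∈ oddDiagram x ↔ (r, j) ∈ oddDiagram y := fun r j => by rw [hD]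
  simp only [mem_oddDiagram_val] at mem
  have hpar : (i : ℕ) % 2 = (l : ℕ) % 2 := by
    have := mem i (x i)
    rw [hl'] at this
    grind
  refine ⟨hil, by simpa [hl] using hi, rfl, hpar.symm, fun s hs his => ?_⟩
  rw [Equiv.Perm.mul_apply, Equiv.Perm.mul_apply, Equiv.Perm.mul_apply, Equiv.swap_apply_left,
    Equiv.swap_apply_right, Equiv.swap_apply_of_ne_of_ne (by grind) (by grind), hl]
  have m1 := mem s (x i)
  have m2 := mem i (y s)
  rw [hl', Equiv.symm_apply_apply] at m1
  rw [Equiv.symm_apply_apply] at m2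
  have n1 : y s ≠ y i := fun e => by have := y.injective e; grind
  have n2 : y s ≠ x i := fun e => by have := y.injective (e.trans hl.symm); grind
  grind

/-- At the smallest value whose positions in two permutations with the same odd diagram differ,
the one with the earlier position has an upward odd step. -/
lemma oddEdge_of_first_value {x y : Equiv.Perm (Fin n)} (hD : oddDiagram x = oddDiagram y)
    {j : Fin n} (hlt : ∀ a < j, x.symm a = y.symm a) (hj : x.symm j < y.symm j) :
    OddEdge ((x.symm j : ℕ) % 2) x (x.symm j) (y.symm j) := by
  obtain ⟨i, rfl⟩ := x.surjective j
  obtain ⟨k, hk⟩ := y.surjective (x i)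
  have hk' : y.symm (x i) = k := by rw [← hk, Equiv.symm_apply_apply]
  rw [hk', Equiv.symm_apply_apply] at hj ⊢
  have mem : ∀ r j, (r, j) ∈ oddDiagram x ↔ (r, j) ∈ oddDiagram y := fun r j => by rw [hD]
  simp only [mem_oddDiagram_val] at mem
  have small : ∀ r, x r < x i → y r = x r := fun r hr => by
    have := hlt _ hr
    rw [Equiv.symm_apply_apply] at this
    rw [Equiv.eq_symm_apply] at this
    exact this
  have small' : ∀ r, y r < x i → x r = y r := fun r hr => by
    have := hlt _ hr
    rw [Equiv.symm_apply_apply, Equiv.symm_apply_eq] at this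
    exact this.symm
  have big : ∀ r, r ≠ k → x i ≤ x r → x i < y r := fun r hr h => by
    by_contra hcon
    rcases (not_lt.1 hcon).lt_or_eq with h' | h'
    · have := small' r h'; grind
    · exact hr (y.injective (h'.trans hk.symm))
  have hxk : x i < x k := by
    by_contra hcon
    rcases (not_lt.1 hcon).lt_or_eq with h' | h'
    · have := small k h'; grind
    · exact hj.ne' (x.injective h')
  have hpar : (i : ℕ) % 2 = (k : ℕ) % 2 := by
    have := mem i (x i)
    rw [hk'] at this
    have := big i hj.ne le_rfl
    grind
  refine ⟨hj, hxk, rfl, hpar.symm, fun s hs his => ?_⟩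
  have m1 := mem s (x i)
  have m2 := mem k (x s)
  rw [hk', Equiv.symm_apply_apply] at m1
  rw [Equiv.symm_apply_apply] at m2
  have hsk : s ≠ k := by grind
  have b := big s hsk
  have n1 : x s ≠ x i := fun e => by have := x.injective e; grind
  have n2 : x s ≠ x k := fun e => hsk (x.injective e)
  grind

lemma oddDiagram_eq_of_path {x y : Equiv.Perm (Fin n)}
    (h : Relation.ReflTransGen AnyOddStep x y) : oddDiagram y = oddDiagram x := by
  induction h with
  | refl => rfl
  | tail _ h ih =>
    obtain ⟨c, i, k, e, rfl⟩ := h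
    rw [e.oddDiagram_eq, ih]

/-- Every odd diagram class has a least element for the order generated by odd steps. -/
lemma exists_path_from {D : Set (Fin n × Fin n)} (hD : ∃ w : Equiv.Perm (Fin n), oddDiagram w = D) :
    ∃ u, oddDiagram u = D ∧ ∀ w, oddDiagram w = D → Relation.ReflTransGen AnyOddStep u w := by
  let f : Equiv.Perm (Fin n) → Lex (Fin n → Fin n) := fun w => toLex (w : Fin n → Fin n)
  have hf : Function.Injective f := fun a b h => Equiv.coe_fn_injective (toLex.injective h)
  obtain ⟨u, hu, hmin⟩ := Set.exists_min_image {w | oddDiagram w = D} f (Set.toFinite _) hD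
  refine ⟨u, hu, fun w => ?_⟩
  induction w using (InvImage.wf f (wellFounded_lt (α := Lex (Fin n → Fin n)))).induction with
  | _ w ih =>
    intro hw
    rcases (hmin w hw).eq_or_lt with h | h
    · rw [hf h]
    · obtain ⟨i, h1, h2⟩ := h
      have e := oddEdge_of_first_position (hu.trans hw.symm) h1 h2
      have hd := e.oddDiagram_eq
      have hl : i < w.symm (u i) := e.1
      rw [mul_assoc, Equiv.swap_mul_self, mul_one] at hd
      refine (ih _ ⟨i, fun j hj => ?_, ?_⟩ (hd.symm.trans hw)).tail
        ⟨_, _, _, e, by rw [mul_assoc, Equiv.swap_mul_self, mul_one]⟩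
      · exact congrArg w (Equiv.swap_apply_of_ne_of_ne hj.ne (hj.trans hl).ne)
      · change (w * Equiv.swap i (w.symm (u i))) i < w i
        rw [Equiv.Perm.mul_apply, Equiv.swap_apply_left, Equiv.apply_symm_apply]
        exact h2

/-- Every odd diagram class has a greatest element for the order generated by odd steps. -/
lemma exists_path_to {D : Set (Fin n × Fin n)} (hD : ∃ w : Equiv.Perm (Fin n), oddDiagram w = D) :
    ∃ v, oddDiagram v = D ∧ ∀ w, oddDiagram w = D → Relation.ReflTransGen AnyOddStep w v := by
  let f : Equiv.Perm (Fin n) → Lex (Fin n → Fin n) := fun w => toLex (w.symm : Fin n → Fin n)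
  have hf : Function.Injective f := fun a b h =>
    Equiv.symm_bijective.injective (Equiv.coe_fn_injective (toLex.injective h))
  obtain ⟨v, hv, hmax⟩ := Set.exists_max_image {w | oddDiagram w = D} f (Set.toFinite _) hD
  refine ⟨v, hv, fun w => ?_⟩
  induction w using (InvImage.wf f (wellFounded_gt (α := Lex (Fin n → Fin n)))).induction with
  | _ w ih =>
    intro hw
    rcases (hmax w hw).eq_or_lt with h | h
    · rw [hf h]
    · obtain ⟨j, h1, h2⟩ := h
      have e := oddEdge_of_first_value (hw.trans hv.symm) h1 h2
      have hb : j < w (v.symm j) := by simpa using e.2.1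
      refine (ih _ ⟨j, fun a ha => ?_, ?_⟩ (e.oddDiagram_eq.trans hw)).head
        ⟨_, _, _, e, rfl⟩
      · change w.symm a = Equiv.swap (w.symm j) (v.symm j) (w.symm a)
        rw [Equiv.swap_apply_of_ne_of_ne]
        · exact fun h => ha.ne (w.symm.injective h)
        · intro h
          rw [Equiv.symm_apply_eq] at h
          exact (ha.trans hb).ne h
      · change w.symm j < Equiv.swap (w.symm j) (v.symm j) (w.symm j)
        rw [Equiv.swap_apply_left]
        exact h2

end OddDiagram

/-- Every odd diagram class in `S_n` is an interval in the Bruhat order. -/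
theorem odd_diagram_class_is_interval {n : ℕ} (D : Set (Fin n × Fin n))
    (hD : ∃ w : Equiv.Perm (Fin n), oddDiagram w = D) :
    ∃ u v : Equiv.Perm (Fin n), bruhatLE u v ∧
      ∀ w : Equiv.Perm (Fin n), oddDiagram w = D ↔ (bruhatLE u w ∧ bruhatLE w v) := by
  obtain ⟨u, hu, hmin⟩ := exists_path_from hD
  obtain ⟨v, hv, hmax⟩ := exists_path_to hD
  refine ⟨u, v, bruhatLE_of_path (hmin v hv), fun w =>
    ⟨fun hw => ⟨bruhatLE_of_path (hmin w hw), bruhatLE_of_path (hmax w hw)⟩, ?_⟩⟩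
  rintro ⟨huw, hwv⟩
  induction huw with
  | refl => exact hu
  | tail _ hs ih =>
    obtain ⟨i, k, hik, hx, rfl⟩ := hs
    have hxD := ih (Relation.ReflTransGen.head ⟨i, k, hik, hx, rfl⟩ hwv)
    obtain ⟨c, e⟩ := oddEdge_of_bruhatLE (hmax _ hxD) hik hx hwv
    rw [e.oddDiagram_eq, hxD]
end

section
/- Let u ∈ S_n and let (i j) be a transposition with i < j. Set m = min{u(i), u(j)} and M = max{u(i), u(j)}. If (1) i and j have the same parity, (2) u(p) < m for all p ∈ {i+1, i+3, ..., j-1}, and (3) u(q) ∉ [m, M] for all q ∈ {j+1, j+3, ...} with q ≤ n, then u and u·(i j) have the same odd diagram. -/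
open Equiv Finset Polynomial

/-- Brenti--Carnevale--Tenner's criterion for a legal transposition. -/
theorem legal_transposition_criterion {n : ℕ} (u : Equiv.Perm (Fin n)) (i j : Fin n)
    (hij : i < j)
    (h1 : (i : ℕ) % 2 = (j : ℕ) % 2)
    (h2 : ∀ p : Fin n, i < p → p < j → (p : ℕ) % 2 ≠ (i : ℕ) % 2 → u p < min (u i) (u j))
    (h3 : ∀ q : Fin n, j < q → (q : ℕ) % 2 ≠ (j : ℕ) % 2 →
      ¬ (min (u i) (u j) ≤ u q ∧ u q ≤ max (u i) (u j))) :
    oddDiagram (u * Equiv.swap i j) = oddDiagram u := by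
  ext ⟨a, c⟩
  obtain ⟨b, rfl⟩ := u.surjective c
  have hinv : u⁻¹ (u b) = b := u.symm_apply_apply b
  have hbetween_a := h2 a
  have hbetween_b := h2 b
  have hright_b := h3 b
  simp only [lt_min_iff, min_le_iff, le_max_iff] at hbetween_a hbetween_b hright_b
  clear h2 h3
  simp only [oddDiagram, Set.mem_ofPred_eq, mul_inv_rev, Equiv.swap_inv, Equiv.Perm.mul_apply,
    hinv, Equiv.swap_apply_def]
  split_ifs <;> grind
end

section
/- Let u ≠ v be permutations in S_n with the same odd diagram, let k = min{i : u^{-1}(i) ≠ v^{-1}(i)}, a = u^{-1}(k) and b = v^{-1}(k). Then u·(a b) has the same odd diagram as u (the transposition (a b) is legal for u). -/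
open Equiv Finset Polynomial

theorem mk_mem_oddDiagram {n : ℕ} (w : Equiv.Perm (Fin n)) (i c : Fin n) :
    (i, w c) ∈ oddDiagram w ↔ w c < w i ∧ i < c ∧ (i : ℕ) % 2 ≠ (c : ℕ) % 2 := by
  simp [oddDiagram]

/-- A transposition of two positions of equal parity is legal when every position of the other
parity carries a smaller value than both if it lies between them, and a value that does not
separate theirs if it lies to the right of both. -/
theorem oddDiagram_mul_swap_eq {n : ℕ} (w : Equiv.Perm (Fin n)) (a b : Fin n)
    (hab : (a : ℕ) % 2 = (b : ℕ) % 2)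
    (hbetween : ∀ c : Fin n, (c : ℕ) % 2 ≠ (a : ℕ) % 2 → (a < c ∧ c < b ∨ b < c ∧ c < a) →
      w c < w a ∧ w c < w b)
    (hright : ∀ c : Fin n, (c : ℕ) % 2 ≠ (a : ℕ) % 2 → a < c → b < c →
      (w c < w a ↔ w c < w b)) :
    oddDiagram (w * Equiv.swap a b) = oddDiagram w := by
  ext ⟨i, j⟩
  obtain ⟨c, rfl⟩ := w.surjective j
  have hswap : (w * Equiv.swap a b) (Equiv.swap a b c) = w c := by simp
  rw [mk_mem_oddDiagram]
  nth_rewrite 1 [← hswap]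
  rw [mk_mem_oddDiagram, hswap, Equiv.Perm.mul_apply]
  have hbi := hbetween i
  have hbc := hbetween c
  have hrc := hright c
  rw [Equiv.swap_apply_def, Equiv.swap_apply_def]
  split_ifs <;> subst_vars <;> grind

/-- If `u ≠ v` have the same odd diagram, `k` is the first value in different
positions in `u` and `v`, `a = u⁻¹ k`, `b = v⁻¹ k`, then `(a b)` is legal for `u`. -/
theorem first_difference_transposition_legal {n : ℕ} (u v : Equiv.Perm (Fin n))
    (hne : u ≠ v) (hD : oddDiagram u = oddDiagram v) (k : Fin n)
    (hk : u⁻¹ k ≠ v⁻¹ k) (hkmin : ∀ i : Fin n, i < k → u⁻¹ i = v⁻¹ i) :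
    oddDiagram (u * Equiv.swap (u⁻¹ k) (v⁻¹ k)) = oddDiagram u := by
  obtain ⟨a, ha⟩ : ∃ a, u⁻¹ k = a := ⟨_, rfl⟩
  obtain ⟨b, hb⟩ : ∃ b, v⁻¹ k = b := ⟨_, rfl⟩
  rw [ha, hb] at hk ⊢
  have hua : u a = k := by simp [← ha]
  have hvb : v b = k := by simp [← hb]
  have hsmall : ∀ c, u c < k ↔ v c < k := by
    intro c
    constructor
    · intro h
      have hpos : c = v⁻¹ (u c) := by simpa using hkmin _ h
      rwa [Equiv.Perm.eq_inv_iff_eq.1 hpos]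
    · intro h
      have hpos : u⁻¹ (v c) = c := by simpa using hkmin _ h
      rwa [← Equiv.Perm.inv_eq_iff_eq.1 hpos]
  have hu_ne : ∀ c, c ≠ a → u c ≠ k := fun c hc h => hc (u.injective (h.trans hua.symm))
  have hv_ne : ∀ c, c ≠ b → v c ≠ k := fun c hc h => hc (v.injective (h.trans hvb.symm))
  have hcol : ∀ i, (k < u i ∧ i < a ∧ (i : ℕ) % 2 ≠ (a : ℕ) % 2) ↔
      (k < v i ∧ i < b ∧ (i : ℕ) % 2 ≠ (b : ℕ) % 2) := by
    intro i
    have hu := mk_mem_oddDiagram u i a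
    have hv := mk_mem_oddDiagram v i b
    rw [hua] at hu
    rw [hvb] at hv
    rw [← hu, ← hv, hD]
  have hub : k < u b := by
    have := hsmall b
    have := hu_ne b hk.symm
    grind
  have hva : k < v a := by
    have := hsmall a
    have := hv_ne a hk
    grind
  have hab : (a : ℕ) % 2 = (b : ℕ) % 2 := by
    have := hcol a
    have := hcol b
    grind
  refine oddDiagram_mul_swap_eq u a b hab (fun c hc hlt => ?_) (fun c hc _ hbc => ?_)
  · have := hcol c
    have := hsmall c
    have := hu_ne c
    have := hv_ne c
    grind
  · rw [hua]
    refine ⟨fun h => h.trans hub, fun h => ?_⟩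
    have hmem : (b, u c) ∈ oddDiagram u := (mk_mem_oddDiagram u b c).2 ⟨h, hbc, by grind⟩
    rw [hD] at hmem
    exact hvb ▸ hmem.1
end

section
/- With the standing setup, a < b and u(a) < u(b). -/
open Equiv Finset Polynomial

/-- Going up in the Bruhat order decreases the number of positions `t ≤ p` with value at most `q`. -/
theorem bruhatLE.card_le {n : ℕ} {x y : Equiv.Perm (Fin n)} (h : bruhatLE x y) (p q : Fin n) :
    (univ.filter fun t => t ≤ p ∧ y t ≤ q).card ≤ (univ.filter fun t => t ≤ p ∧ x t ≤ q).card := by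
  induction h with
  | refl => exact le_rfl
  | tail _ hstep ih =>
    rename_i z y _
    refine le_trans ?_ ih
    obtain ⟨i, j, hij, hz, rfl⟩ := hstep
    by_cases hj : j ≤ p
    · refine card_le_card_of_injOn (Equiv.swap i j) (fun t ht => ?_) (Equiv.injective _).injOn
      rw [mem_coe, mem_filter_univ] at ht ⊢
      refine ⟨?_, ht.2⟩
      rw [Equiv.swap_apply_def]
      split_ifs
      exacts [hj, hij.le.trans hj, ht.1]
    · refine card_le_card fun t ht => ?_
      rw [mem_filter_univ, Perm.mul_apply] at ht
      rw [mem_filter_univ]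
      refine ⟨ht.1, ?_⟩
      have htj : t ≠ j := fun e => hj (e ▸ ht.1)
      by_cases hti : t = i
      · subst hti
        rw [Equiv.swap_apply_left] at ht
        exact hz.le.trans ht.2
      · rw [Equiv.swap_apply_of_ne_of_ne hti htj] at ht
        exact ht.2

/-- With the standing setup, `a < b` and `u(a) < u(b)`. -/
theorem a_lt_b_and_ua_lt_ub {n : ℕ} (D : Set (Fin n × Fin n)) (u v : Equiv.Perm (Fin n))
    (hu : oddDiagram u = D) (hv : oddDiagram v = D) (hne : u ≠ v)
    (hint : ∀ w : Equiv.Perm (Fin n), oddDiagram w = D ↔ (bruhatLE u w ∧ bruhatLE w v))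
    (k : Fin n) (hk : u⁻¹ k ≠ v⁻¹ k) (hkmin : ∀ i : Fin n, i < k → u⁻¹ i = v⁻¹ i) :
    u⁻¹ k < v⁻¹ k ∧ u (u⁻¹ k) < u (v⁻¹ k) := by
  have huv : bruhatLE u v := ((hint u).1 hu).2
  have hagree : ∀ t, u t < k → v t = u t := fun t ht => by
    have := hkmin (u t) ht
    rw [Equiv.Perm.inv_def, Equiv.symm_apply_apply] at this
    exact (Perm.eq_inv_iff_eq.1 this)
  constructor
  · by_contra hlt
    have hba : v⁻¹ k < u⁻¹ k := lt_of_le_of_ne (not_lt.1 hlt) (Ne.symm hk)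
    refine absurd (huv.card_le (v⁻¹ k) k) (not_le.2 (card_lt_card ?_))
    have hltk : ∀ t, t ≤ v⁻¹ k → u t ≤ k → u t < k := fun t ht htk =>
      lt_of_le_of_ne htk fun e => (ht.trans_lt hba).ne (Perm.eq_inv_iff_eq.2 e)
    rw [Finset.ssubset_iff_of_subset]
    · refine ⟨v⁻¹ k, by simp, fun h => ?_⟩
      simp only [mem_filter, mem_univ, true_and] at h
      have hlt' := hltk _ h.1 h.2
      have := hagree _ hlt'
      rw [Equiv.Perm.inv_def, Equiv.apply_symm_apply] at this
      exact hlt'.ne this.symm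
    · intro t ht
      simp only [mem_filter, mem_univ, true_and] at ht ⊢
      exact ⟨ht.1, (hagree t (hltk t ht.1 ht.2)).trans_le ht.2⟩
  · rw [Equiv.Perm.inv_def, Equiv.apply_symm_apply]
    refine lt_of_le_of_ne (not_lt.1 fun hlt => ?_) fun e => hk (Perm.inv_eq_iff_eq.2 e)
    have := hagree _ hlt
    rw [Equiv.Perm.inv_def, Equiv.apply_symm_apply] at this
    exact hlt.ne this.symm
end

section
/- With the standing setup, the subsequence u(a_1), u(a_2), ..., u(a_m) of u is strictly increasing. -/
open Equiv Finset Polynomial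

theorem mem_oddDiagram_apply {n : ℕ} (w : Equiv.Perm (Fin n)) (p r : Fin n) :
    (p, w r) ∈ oddDiagram w ↔ w r < w p ∧ p < r ∧ (p : ℕ) % 2 ≠ (r : ℕ) % 2 := by
  simp [oddDiagram]

/-- Transposing two inverted entries in positions of equal parity preserves the odd diagram if
no entry of the opposite parity interferes. -/
theorem oddDiagram_mul_swap {n : ℕ} (u : Equiv.Perm (Fin n)) {i j : Fin n} (hij : i < j)
    (hpar : (i : ℕ) % 2 = (j : ℕ) % 2) (hinv : u j < u i)
    (hright : ∀ l, i < l → (l : ℕ) % 2 ≠ (i : ℕ) % 2 → u j < u l → u i < u l)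
    (hmid : ∀ l, i < l → l < j → (l : ℕ) % 2 ≠ (i : ℕ) % 2 → u l < u j) :
    oddDiagram (u * Equiv.swap i j) = oddDiagram u := by
  ext ⟨p, c⟩
  obtain ⟨r, rfl⟩ := u.surjective c
  rw [mem_oddDiagram_apply]
  have hur : ∀ s, u s = (u * Equiv.swap i j) (Equiv.swap i j s) := by simp
  rw [hur r, mem_oddDiagram_apply, ← hur r, Equiv.Perm.mul_apply]
  have hri := hright r
  have hrp := hright p
  have hmr := hmid r
  have hmp := hmid p
  have inj : ∀ s t, u s = u t → s = t := fun s t h => u.injective h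
  have h1 := inj r i
  have h2 := inj r j
  have h3 := inj p i
  have h4 := inj p j
  clear hright hmid hur inj
  rw [Equiv.swap_apply_def, Equiv.swap_apply_def]
  split_ifs <;> subst_vars <;> grind

/-- The sum `∑ i, i * w i`, which strictly decreases along covering relations of Bruhat order. -/
def positionValueSum {n : ℕ} (w : Equiv.Perm (Fin n)) : ℕ := ∑ i : Fin n, (i : ℕ) * (w i : ℕ)

theorem positionValueSum_mul_swap_lt {n : ℕ} (w : Equiv.Perm (Fin n)) {i j : Fin n}
    (hij : i < j) (hw : w i < w j) :
    positionValueSum (w * Equiv.swap i j) < positionValueSum w := by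
  unfold positionValueSum
  have hji : j ∈ (Finset.univ : Finset (Fin n)).erase i := by simp [hij.ne']
  rw [← Finset.add_sum_erase _ _ (Finset.mem_univ i), ← Finset.add_sum_erase _ _ hji,
    ← Finset.add_sum_erase (a := i) _ (fun l : Fin n => (l : ℕ) * (w l : ℕ)) (Finset.mem_univ i),
    ← Finset.add_sum_erase _ _ hji]
  have hrest : ∀ l ∈ ((Finset.univ : Finset (Fin n)).erase i).erase j,
      (l : ℕ) * ((w * Equiv.swap i j) l : ℕ) = (l : ℕ) * (w l : ℕ) := by
    intro l hl
    simp only [Finset.mem_erase] at hl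
    rw [Equiv.Perm.mul_apply, Equiv.swap_apply_of_ne_of_ne hl.2.1 hl.1]
  rw [Finset.sum_congr rfl hrest]
  simp only [Equiv.Perm.mul_apply, Equiv.swap_apply_left, Equiv.swap_apply_right]
  have hij' : (i : ℕ) < j := hij
  have hw' : (w i : ℕ) < w j := hw
  nlinarith

theorem bruhatLE.positionValueSum_le {n : ℕ} {x y : Equiv.Perm (Fin n)} (h : bruhatLE x y) :
    positionValueSum y ≤ positionValueSum x := by
  induction h with
  | refl => exact le_rfl
  | tail _ hstep ih =>
    obtain ⟨i, j, hij, hw, rfl⟩ := hstep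
    exact (positionValueSum_mul_swap_lt _ hij hw).le.trans ih

theorem not_bruhatLE_mul_swap {n : ℕ} (u : Equiv.Perm (Fin n)) {i j : Fin n} (hij : i < j)
    (hinv : u j < u i) : ¬ bruhatLE u (u * Equiv.swap i j) := by
  intro h
  have hlt := positionValueSum_mul_swap_lt (u * Equiv.swap i j) hij (by simpa using hinv)
  rw [mul_assoc, Equiv.swap_mul_self, mul_one] at hlt
  exact hlt.not_ge h.positionValueSum_le

section FirstDifference

variable {n : ℕ} {u v : Equiv.Perm (Fin n)} {k : Fin n}

theorem apply_lt_iff_of_inv_eq_below (hkmin : ∀ i : Fin n, i < k → u⁻¹ i = v⁻¹ i) (l : Fin n) :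
    u l < k ↔ v l < k := by
  constructor <;> intro h
  · have := hkmin _ h
    rw [show u⁻¹ (u l) = l by simp, Equiv.Perm.eq_inv_iff_eq] at this
    rwa [this]
  · have := hkmin _ h
    rw [show v⁻¹ (v l) = l by simp, Equiv.Perm.inv_eq_iff_eq] at this
    rwa [← this]

/-- The two positions of the first value on which permutations with the same odd diagram differ
have the same parity. -/
theorem parity_eq_of_oddDiagram_eq (hD : oddDiagram u = oddDiagram v)
    (hkmin : ∀ i : Fin n, i < k → u⁻¹ i = v⁻¹ i) (hlt : u⁻¹ k < v⁻¹ k) :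
    (u⁻¹ k : ℕ) % 2 = (v⁻¹ k : ℕ) % 2 := by
  by_contra hpar
  have hv : k < v (u⁻¹ k) := by
    have hle : k ≤ v (u⁻¹ k) := not_lt.1 fun h => by
      simpa using (apply_lt_iff_of_inv_eq_below hkmin (u⁻¹ k)).2 h
    exact hle.lt_of_ne fun h => hlt.ne (Equiv.Perm.eq_inv_iff_eq.2 h.symm)
  have hmem : (u⁻¹ k, k) ∈ oddDiagram v := ⟨hv, hlt, hpar⟩
  rw [← hD] at hmem
  exact lt_irrefl _ hmem.2.1

theorem apply_lt_of_between_of_parity_ne (hD : oddDiagram u = oddDiagram v)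
    (hkmin : ∀ i : Fin n, i < k → u⁻¹ i = v⁻¹ i) (hlt : u⁻¹ k < v⁻¹ k) {l : Fin n}
    (hal : u⁻¹ k < l) (hlb : l < v⁻¹ k) (hpar : (l : ℕ) % 2 ≠ (u⁻¹ k : ℕ) % 2) : u l < k := by
  by_contra hl
  rw [apply_lt_iff_of_inv_eq_below hkmin] at hl
  have hv : k < v l :=
    (not_lt.1 hl).lt_of_ne fun h => hlb.ne (Equiv.Perm.eq_inv_iff_eq.2 h.symm)
  have hmem : (l, k) ∈ oddDiagram v :=
    ⟨hv, hlb, parity_eq_of_oddDiagram_eq hD hkmin hlt ▸ hpar⟩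
  rw [← hD] at hmem
  exact hal.not_gt hmem.2.1

theorem apply_lt_of_right_of_parity_ne (hD : oddDiagram u = oddDiagram v) {l : Fin n}
    (hbl : v⁻¹ k < l) (hpar : (l : ℕ) % 2 ≠ (v⁻¹ k : ℕ) % 2) (hl : u l < u (v⁻¹ k)) :
    u l < k := by
  have hmem : (v⁻¹ k, u l) ∈ oddDiagram u :=
    (mem_oddDiagram_apply u _ _).2 ⟨hl, hbl, hpar.symm⟩
  rw [hD] at hmem
  simpa using hmem.1

end FirstDifference

/-- With the standing setup, the subsequence `u(a₁), …, u(aₘ)` is strictly increasing. -/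
theorem subsequence_increasing {n : ℕ} (D : Set (Fin n × Fin n)) (u v : Equiv.Perm (Fin n))
    (hu : oddDiagram u = D) (hv : oddDiagram v = D) (hne : u ≠ v)
    (hint : ∀ w : Equiv.Perm (Fin n), oddDiagram w = D ↔ (bruhatLE u w ∧ bruhatLE w v))
    (k : Fin n) (hk : u⁻¹ k ≠ v⁻¹ k) (hkmin : ∀ i : Fin n, i < k → u⁻¹ i = v⁻¹ i)
    (m : ℕ) (hm : 0 < m) (aseq : Fin m → Fin n) (hmono : StrictMono aseq)
    (hrange : ∀ i : Fin n, (∃ j : Fin m, aseq j = i) ↔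
      (u⁻¹ k ≤ i ∧ i ≤ v⁻¹ k ∧ u (u⁻¹ k) ≤ u i ∧ u i ≤ u (v⁻¹ k))) :
    StrictMono (fun j : Fin m => u (aseq j)) := by
  have hD : oddDiagram u = oddDiagram v := hu.trans hv.symm
  intro s t hst
  obtain ⟨has, -, -, hsb⟩ := (hrange (aseq s)).1 ⟨s, rfl⟩
  obtain ⟨-, htb, hat, -⟩ := (hrange (aseq t)).1 ⟨t, rfl⟩
  have hij := hmono hst
  have hab : u⁻¹ k < v⁻¹ k := (has.trans_lt hij).trans_le htb
  by_contra hcon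
  have hinv : u (aseq t) < u (aseq s) :=
    (not_lt.1 hcon).lt_of_ne fun h => hij.ne' (u.injective h)
  rw [show u (u⁻¹ k) = k by simp] at hat
  have hpar := parity_eq_of_oddDiagram_eq hD hkmin hab
  have hparity : ∀ l, u⁻¹ k ≤ l → l ≤ v⁻¹ k → k ≤ u l → (l : ℕ) % 2 = (u⁻¹ k : ℕ) % 2 := by
    intro l hal hlb hkl
    by_contra hodd
    have hal' : u⁻¹ k < l := hal.lt_of_ne fun h => hodd (by rw [h])
    have hlb' : l < v⁻¹ k := hlb.lt_of_ne fun h => hodd (by rw [h, hpar])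
    exact hkl.not_gt (apply_lt_of_between_of_parity_ne hD hkmin hab hal' hlb' hodd)
  have hs := hparity _ has (hij.le.trans htb) (hat.trans hinv.le)
  have ht := hparity _ (has.trans hij.le) htb hat
  have hsmall : ∀ l, aseq s < l → l ≤ v⁻¹ k → (l : ℕ) % 2 ≠ (aseq s : ℕ) % 2 → u l < k := by
    intro l hsl hlb hne
    by_contra hl
    exact hne ((hparity l (has.trans hsl.le) hlb (not_lt.1 hl)).trans hs.symm)
  refine not_bruhatLE_mul_swap u hij hinv ((hint _).1 ?_).1
  rw [oddDiagram_mul_swap u hij (hs.trans ht.symm) hinv, hu]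
  · intro l hsl hne htl
    by_contra hls
    refine (hat.trans_lt htl).not_gt ?_
    rcases le_or_gt l (v⁻¹ k) with hlb | hbl
    · exact hsmall l hsl hlb hne
    · have hls' : u l < u (aseq s) :=
        (not_lt.1 hls).lt_of_ne fun h => hsl.ne' (u.injective h)
      exact apply_lt_of_right_of_parity_ne hD hbl (by rwa [← hpar, ← hs])
        (hls'.trans_le hsb)
  · intro l hsl hlt hne
    exact (hsmall l hsl (hlt.le.trans htb) hne).trans_le hat
end
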